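/- Let R be a Cohen–Macaulay local ring and X a resolving subcategory of finitely generated R-modules. If X contains an Ulrich module and X has finite radius, then every module in X is maximal Cohen–Macaulay. -/

import Mathlib

open CategoryTheory

noncomputable section

namespace Paper

variable (R : Type) [CommRing R]

/-- finitely generated projective module (object of `add R`) -/
def FGProj (M : ModuleCat.{0} R) : Prop := Module.Finite R M ∧ Module.Projective R M

/-- a short exact sequence `0 → L → M → N → 0` -/
def SES {L M N : ModuleCat.{0} R} (f : L →ₗ[R] M) (g : M →ₗ[R] N) : Prop :=
  Function.Injective f ∧ Function.Surjective g ∧ LinearMap.ker g = LinearMap.range f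

/-- `N` is a first syzygy of `M`: kernel of a surjection from a f.g. projective onto `M`. -/
def IsSyzygy (N M : ModuleCat.{0} R) : Prop :=
  ∃ (P : ModuleCat.{0} R) (f : P →ₗ[R] M), FGProj R P ∧ Function.Surjective f ∧
    Nonempty (N ≃ₗ[R] LinearMap.ker f)

/-- `N` is an `n`-th syzygy of `M` -/
def IsNthSyzygy : ℕ → ModuleCat.{0} R → ModuleCat.{0} R → Prop
  | 0, N, M => Nonempty (N ≃ₗ[R] M)
  | (n+1), N, M => ∃ K : ModuleCat.{0} R, IsNthSyzygy n K M ∧ IsSyzygy R N K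

/-- `f : M → P` is a left `add R`-approximation -/
def IsLeftApprox {M P : ModuleCat.{0} R} (f : M →ₗ[R] P) : Prop :=
  FGProj R P ∧ ∀ (Q : ModuleCat.{0} R), FGProj R Q → ∀ g : M →ₗ[R] Q,
    ∃ h : P →ₗ[R] Q, h.comp f = g

/-- `N` is a first cosyzygy of `M`: cokernel of a left `add R`-approximation. -/
def IsCosyzygy (N M : ModuleCat.{0} R) : Prop :=
  ∃ (P : ModuleCat.{0} R) (f : M →ₗ[R] P), IsLeftApprox R f ∧
    Nonempty (N ≃ₗ[R] (P ⧸ LinearMap.range f))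

/-- `N` is an `n`-th cosyzygy of `M` -/
def IsNthCosyzygy : ℕ → ModuleCat.{0} R → ModuleCat.{0} R → Prop
  | 0, N, M => Nonempty (N ≃ₗ[R] M)
  | (n+1), N, M => ∃ K : ModuleCat.{0} R, IsNthCosyzygy n K M ∧ IsCosyzygy R N K

/-- `T` is an (Auslander) transpose of `M` -/
def IsTranspose (T M : ModuleCat.{0} R) : Prop :=
  ∃ (P₁ P₀ : ModuleCat.{0} R) (d : P₁ →ₗ[R] P₀) (p : P₀ →ₗ[R] M),
    FGProj R P₁ ∧ FGProj R P₀ ∧ Function.Surjective p ∧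
    LinearMap.ker p = LinearMap.range d ∧
    Nonempty (T ≃ₗ[R] ((Module.Dual R P₁) ⧸ LinearMap.range d.dualMap))

/-- stably isomorphic: `M ⊕ P ≅ N ⊕ Q` with `P`, `Q` f.g. projective -/
def StablyIso (M N : ModuleCat.{0} R) : Prop :=
  ∃ P Q : ModuleCat.{0} R, FGProj R P ∧ FGProj R Q ∧
    Nonempty ((M × P) ≃ₗ[R] (N × Q))

/-- resolving subcategory of `mod R` -/
structure Resolving (X : ModuleCat.{0} R → Prop) : Prop where
  fg : ∀ M, X M → Module.Finite R M
  proj : ∀ M : ModuleCat.{0} R, FGProj R M → X M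
  summand : ∀ M N N' : ModuleCat.{0} R, X M → Nonempty (M ≃ₗ[R] N × N') → X N
  extension : ∀ (L M N : ModuleCat.{0} R) (f : L →ₗ[R] M) (g : M →ₗ[R] N),
      SES R f g → X L → X N → X M
  ker_epi : ∀ (L M N : ModuleCat.{0} R) (f : L →ₗ[R] M) (g : M →ₗ[R] N),
      SES R f g → X M → X N → X L

/-- `Ext^i_R(M, N) = 0` -/
def ExtVanish (M N : ModuleCat.{0} R) (i : ℕ) : Prop :=
  Subsingleton (((Ext R (ModuleCat.{0} R) i).obj (Opposite.op M)).obj N)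

/-- totally reflexive (Gorenstein dimension zero) module -/
def TotallyReflexive (M : ModuleCat.{0} R) : Prop :=
  Function.Bijective (Module.Dual.eval R M) ∧
  ∀ i : ℕ, 0 < i → ExtVanish R M (ModuleCat.of R R) i ∧
    ExtVanish R (ModuleCat.of R (Module.Dual R M)) (ModuleCat.of R R) i

/-- `M` has finite projective dimension -/
def FiniteProjDim (M : ModuleCat.{0} R) : Prop :=
  ∃ (n : ℕ) (N : ModuleCat.{0} R), IsNthSyzygy R n N M ∧ FGProj R N

/-- additive closure of a family of modules -/
def AddClosure (S : ModuleCat.{0} R → Prop) (M : ModuleCat.{0} R) : Prop :=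
  ∃ (k : ℕ) (f : Fin k → ModuleCat.{0} R) (N : ModuleCat.{0} R),
    (∀ i, S (f i)) ∧ Nonempty ((M × N) ≃ₗ[R] ((i : Fin k) → f i))

/-- the operation `[−]`: `add` closure of `R` and all syzygies of modules of `Y` -/
def Bracket (Y : ModuleCat.{0} R → Prop) : ModuleCat.{0} R → Prop :=
  AddClosure R (fun N => FGProj R N ∨ ∃ (M : ModuleCat.{0} R) (i : ℕ), Y M ∧ IsNthSyzygy R i N M)

/-- `Y ∘ Z`: extensions of a module of `Z` by a module of `Y` -/
def ExtOf (Y Z : ModuleCat.{0} R → Prop) (M : ModuleCat.{0} R) : Prop :=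
  ∃ (A B : ModuleCat.{0} R) (f : A →ₗ[R] M) (g : M →ₗ[R] B), Y A ∧ Z B ∧ SES R f g

/-- the ball `[C]_n` of radius `n` centered at `C` -/
def Ball (C : ModuleCat.{0} R) : ℕ → ModuleCat.{0} R → Prop
  | 0 => fun _ => False
  | 1 => Bracket R (fun M => Nonempty (M ≃ₗ[R] C))
  | (n+2) => Bracket R (ExtOf R (Ball C (n+1)) (Bracket R (fun M => Nonempty (M ≃ₗ[R] C))))

/-- `X` has finite radius: `X ⊆ [C]_{n+1}` for some `C ∈ X`. -/
def FiniteRadius (X : ModuleCat.{0} R → Prop) : Prop :=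
  ∃ (C : ModuleCat.{0} R) (n : ℕ), X C ∧ ∀ M, X M → Ball R C (n + 1) M

/-- `depth_A M ≥ n`: there is a weakly `M`-regular sequence of length `n` in the maximal ideal -/
def DepthGE (A : Type) [CommRing A] [IsLocalRing A]
    (M : Type) [AddCommGroup M] [Module A M] (n : ℕ) : Prop :=
  ∃ rs : List A, rs.length = n ∧ (∀ x ∈ rs, x ∈ IsLocalRing.maximalIdeal A) ∧
    RingTheory.Sequence.IsWeaklyRegular M rs

/-- `M` is free at the prime `p` -/
def FreeAt (M : ModuleCat.{0} R) (p : PrimeSpectrum R) : Prop :=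
  Module.Free (Localization.AtPrime p.asIdeal) (LocalizedModule p.asIdeal.primeCompl M)

/-- locally free on the punctured spectrum of a local ring -/
def LocFreeOnPunctured [IsLocalRing R] (M : ModuleCat.{0} R) : Prop :=
  ∀ p : PrimeSpectrum R, p.asIdeal ≠ IsLocalRing.maximalIdeal R → FreeAt R M p

/-- a Gorenstein local ring: `R` has finite injective dimension over itself -/
def Gorenstein : Prop :=
  ∃ n : ℕ, ∀ i : ℕ, n < i → ∀ M : ModuleCat.{0} R, ExtVanish R M (ModuleCat.of R R) i

/-- the annihilator of the `i`-th local cohomology module `H^i_I(M)` -/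
def aa (I : Ideal R) (i : ℕ) (M : ModuleCat.{0} R) : Ideal R :=
  Module.annihilator R ((localCohomology I i).obj M)

/-- an Ulrich module over a CM local ring of dimension `d` -/
def Ulrich [IsLocalRing R] (d : ℕ) (U : ModuleCat.{0} R) : Prop :=
  Module.Finite R U ∧ DepthGE R U d ∧ ¬ Subsingleton U ∧
  ∃ xs : List R, xs.length = d ∧ (∀ x ∈ xs, x ∈ IsLocalRing.maximalIdeal R) ∧
    RingTheory.Sequence.IsWeaklyRegular U xs ∧
    (IsLocalRing.maximalIdeal R) • (⊤ : Submodule R U) = Ideal.ofList xs • ⊤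

end Paper

open Paper

namespace Paper

/-- `a` annihilates `Ext^i(Q, N)` for all `i < d`. -/
def Kills {R : Type} [CommRing R] (Q : ModuleCat.{0} R) (a : R) (d : ℕ) (N : ModuleCat.{0} R) :
    Prop :=
  ∀ i < d, ∀ e : Abelian.Ext Q N i, a • e = 0

section A
variable {R : Type} [CommRing R] {Q : ModuleCat.{0} R} {d : ℕ}

lemma SES.shortComplex {L M N : ModuleCat.{0} R} {f : L →ₗ[R] M} {g : M →ₗ[R] N}
    (h : SES R f g) : ∃ w, (ShortComplex.mk (ModuleCat.ofHom f) (ModuleCat.ofHom g) w).ShortExact := by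
  obtain ⟨hf, hg, hk⟩ := h
  have hex : Function.Exact f g := LinearMap.exact_iff.2 hk
  refine ⟨?_, ?_⟩
  · rw [← ModuleCat.ofHom_comp, hex.linearMap_comp_eq_zero]; rfl
  · have := (ModuleCat.mono_iff_injective (ModuleCat.ofHom f)).2 hf
    have := (ModuleCat.epi_iff_surjective (ModuleCat.ofHom g)).2 hg
    exact ShortComplex.ShortExact.mk (ModuleCat.shortComplex_exact _ hex)

lemma Kills.of_sum {a : R} {M : ModuleCat.{0} R} {k : ℕ} (f : Fin k → ModuleCat.{0} R)
    (α : ∀ i, M →ₗ[R] f i) (β : ∀ i, f i →ₗ[R] M)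
    (h : ∑ i, (β i).comp (α i) = LinearMap.id) (hf : ∀ i, Kills Q a d (f i)) :
    Kills Q a d M := by
  intro i hi e
  have h1 : e = e.comp (Abelian.Ext.mk₀ (∑ j, ModuleCat.ofHom (α j) ≫ ModuleCat.ofHom (β j)))
      (add_zero i) := by
    have : ∑ j, ModuleCat.ofHom (α j) ≫ ModuleCat.ofHom (β j) = 𝟙 M := by
      apply ModuleCat.hom_ext
      rw [ModuleCat.hom_sum]
      simpa using h
    rw [this, Abelian.Ext.comp_mk₀_id]
  rw [h1, Abelian.Ext.mk₀_sum, Abelian.Ext.comp_sum, Finset.smul_sum]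
  apply Finset.sum_eq_zero
  intro j _
  rw [← Abelian.Ext.mk₀_comp_mk₀,
    ← Abelian.Ext.comp_assoc_of_second_deg_zero, ← Abelian.Ext.smul_comp, hf j i hi, Abelian.Ext.zero_comp]

lemma Kills.equiv {a : R} {M N : ModuleCat.{0} R} (e : M ≃ₗ[R] N) (h : Kills Q a d N) :
    Kills Q a d M :=
  Kills.of_sum (k := 1) (fun _ => N) (fun _ => e.toLinearMap) (fun _ => e.symm.toLinearMap)
    (by ext; simp) (fun _ => h)

lemma Kills.ext {a b : R} {A M B : ModuleCat.{0} R} {f : A →ₗ[R] M} {g : M →ₗ[R] B}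
    (hS : SES R f g) (hA : Kills Q a d A) (hB : Kills Q b d B) : Kills Q (a * b) d M := by
  obtain ⟨w, hS⟩ := hS.shortComplex
  intro i hi e
  have h1 : (b • e).comp (Abelian.Ext.mk₀ (ModuleCat.ofHom g)) (add_zero i) = 0 := by
    rw [Abelian.Ext.smul_comp]; exact hB i hi _
  obtain ⟨x, hx⟩ := Abelian.Ext.covariant_sequence_exact₂ Q hS (b • e) h1
  rw [mul_smul, ← hx, ← Abelian.Ext.smul_comp, hA i hi, Abelian.Ext.zero_comp]

lemma Kills.addClosure {a : R} {S : ModuleCat.{0} R → Prop} (hS : ∀ N, S N → Kills Q a d N)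
    {M : ModuleCat.{0} R} (hM : AddClosure R S M) : Kills Q a d M := by
  obtain ⟨k, f, N, hf, ⟨e⟩⟩ := hM
  refine Kills.of_sum f (fun i => LinearMap.proj i ∘ₗ e.toLinearMap ∘ₗ LinearMap.inl R M N)
    (fun i => LinearMap.fst R M N ∘ₗ e.symm.toLinearMap ∘ₗ LinearMap.single R (fun i => (f i : Type)) i) ?_
    (fun i => hS _ (hf i))
  ext m
  have h2 : ∑ i, Pi.single i ((e (m, 0)) i) = e (m, 0) := Finset.univ_sum_single _
  simp only [LinearMap.sum_apply, LinearMap.comp_apply, LinearMap.proj_apply, LinearMap.inl_apply,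
    LinearMap.coe_single, LinearEquiv.coe_coe]
  rw [← map_sum, ← map_sum, h2]
  simp

lemma Kills.mul {a : R} (b : R) {M : ModuleCat.{0} R} (h : Kills Q a d M) : Kills Q (b * a) d M := by
  intro i hi e
  rw [mul_smul, h i hi, smul_zero]

lemma Kills.proj {P : ModuleCat.{0} R} (hP : FGProj R P) (hR : Kills Q (1 : R) d (ModuleCat.of R R)) :
    Kills Q (1 : R) d P := by
  obtain ⟨h1, h2⟩ := hP
  obtain ⟨n, f, g, -, -, hfg⟩ := Module.Finite.exists_comp_eq_id_of_projective R P
  refine Kills.of_sum (k := n) (fun _ => ModuleCat.of R R) (fun i => LinearMap.proj i ∘ₗ g)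
    (fun i => f ∘ₗ LinearMap.single R (fun _ => R) i) ?_ (fun _ => hR)
  ext m
  have h2 : ∑ i, Pi.single i (g m i) = g m := Finset.univ_sum_single _
  have h3 : f (g m) = m := LinearMap.congr_fun hfg m
  simp only [LinearMap.sum_apply, LinearMap.comp_apply, LinearMap.proj_apply,
    LinearMap.coe_single]
  rw [← map_sum, h2, h3]; rfl

lemma ses_ker {P M : ModuleCat.{0} R} {f : P →ₗ[R] M} (hf : Function.Surjective f) :
    SES R (L := ModuleCat.of R (LinearMap.ker f)) (M := P) (N := M) (LinearMap.ker f).subtype f :=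
  ⟨Subtype.val_injective, hf, by simp⟩

lemma Kills.ker {a : R} {P M : ModuleCat.{0} R} {f : P →ₗ[R] M} (hf : Function.Surjective f)
    (hP : Kills Q (1 : R) d P) (hM : Kills Q a d M) :
    Kills Q a d (ModuleCat.of R (LinearMap.ker f)) := by
  obtain ⟨w, hS⟩ := (ses_ker hf).shortComplex
  intro i hi e
  have h1 : e.comp (Abelian.Ext.mk₀ (ModuleCat.ofHom (LinearMap.ker f).subtype)) (add_zero i) = 0 := by
    have := hP i hi (e.comp (Abelian.Ext.mk₀ (ModuleCat.ofHom (LinearMap.ker f).subtype)) (add_zero i))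
    rwa [one_smul] at this
  rcases i with _ | i
  · have := hS.mono_f
    have h2 := Abelian.Ext.postcomp_mk₀_injective_of_mono Q
      (ModuleCat.ofHom (LinearMap.ker f).subtype) (hf := this)
    have h3 : e = 0 := h2 (by simpa using h1)
    rw [h3, smul_zero]
  · obtain ⟨x, hx⟩ := Abelian.Ext.covariant_sequence_exact₁ Q hS e h1 rfl
    rw [← hx, ← Abelian.Ext.smul_comp, hM i (by omega), Abelian.Ext.zero_comp]

lemma kills_of_ker {a : R} {P M : ModuleCat.{0} R} {f : P →ₗ[R] M} (hf : Function.Surjective f)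
    (hP : Kills Q (1 : R) d P) {i : ℕ} (hi : i < d)
    (hM : ∀ e : Abelian.Ext Q (ModuleCat.of R (LinearMap.ker f)) (i + 1), a • e = 0)
    (e : Abelian.Ext Q M i) : a • e = 0 := by
  obtain ⟨w, hS⟩ := (ses_ker hf).shortComplex
  obtain ⟨x, hx⟩ := Abelian.Ext.covariant_sequence_exact₃ Q hS (a • e) (n₁ := i + 1) rfl
    (by rw [Abelian.Ext.smul_comp]; exact hM _)
  have := hP i hi x
  rw [one_smul] at this
  rw [← hx, this, Abelian.Ext.zero_comp]

lemma Kills.syzygy {a : R} (hR : Kills Q (1 : R) d (ModuleCat.of R R)) {N M : ModuleCat.{0} R}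
    (h : IsSyzygy R N M) (hM : Kills Q a d M) : Kills Q a d N := by
  obtain ⟨P, f, hP, hf, ⟨e⟩⟩ := h
  exact Kills.equiv (N := ModuleCat.of R (LinearMap.ker f)) e (Kills.ker hf (Kills.proj hP hR) hM)

lemma Kills.nthSyzygy {a : R} (hR : Kills Q (1 : R) d (ModuleCat.of R R)) (n : ℕ)
    {N M : ModuleCat.{0} R}
    (h : IsNthSyzygy R n N M) (hM : Kills Q a d M) : Kills Q a d N := by
  induction n generalizing N with
  | zero => obtain ⟨e⟩ := h; exact Kills.equiv e hM
  | succ n ih =>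
    obtain ⟨K, hK, hN⟩ := h
    exact Kills.syzygy hR hN (ih hK)

lemma Kills.bracket {a : R} (hR : Kills Q (1 : R) d (ModuleCat.of R R))
    {Y : ModuleCat.{0} R → Prop} (hY : ∀ N, Y N → Kills Q a d N) {M : ModuleCat.{0} R}
    (hM : Bracket R Y M) : Kills Q a d M := by
  refine Kills.addClosure ?_ hM
  rintro N (hN | ⟨M, i, hM, hN⟩)
  · simpa using (Kills.proj hN hR).mul a
  · exact Kills.nthSyzygy hR i hN (hY _ hM)

lemma Kills.ball {a : R} (hR : Kills Q (1 : R) d (ModuleCat.of R R)) {C : ModuleCat.{0} R}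
    (hC : Kills Q a d C) (n : ℕ) {M : ModuleCat.{0} R} (hM : Ball R C (n + 1) M) :
    Kills Q (a ^ (n + 1)) d M := by
  have h1 : ∀ M, Bracket R (fun M => Nonempty (M ≃ₗ[R] C)) M → Kills Q a d M := fun M hM =>
    Kills.bracket hR (fun N ⟨e⟩ => Kills.equiv e hC) hM
  induction n generalizing M with
  | zero => simpa using h1 M hM
  | succ n ih =>
    refine Kills.bracket hR ?_ hM
    rintro N ⟨A, B, f, g, hA, hB, hS⟩
    rw [pow_succ]
    exact Kills.ext hS (ih hA) (h1 B hB)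

end A
end Paper

namespace Paper

section C
open scoped Pointwise
variable {R : Type} [CommRing R]

/-- Classes of f.g. modules closed under retracts and extensions, containing the projectives. -/
structure Res (Y : ModuleCat.{0} R → Prop) : Prop where
  fg : ∀ M, Y M → Module.Finite R M
  proj : ∀ M : ModuleCat.{0} R, FGProj R M → Y M
  retract : ∀ (M N : ModuleCat.{0} R) (i : N →ₗ[R] M) (l : M →ₗ[R] N), (∀ x, l (i x) = x) →
    Y M → Y N
  ext : ∀ (L M N : ModuleCat.{0} R) (f : L →ₗ[R] M) (g : M →ₗ[R] N),
      Function.Injective f → Function.Surjective g → (∀ x, g x = 0 ↔ ∃ y, f y = x) →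
      Y L → Y N → Y M

/-- modules all of whose syzygies lie in `Y` -/
def Suc (Y : ModuleCat.{0} R → Prop) (N : ModuleCat.{0} R) : Prop :=
  Module.Finite R N ∧ ∀ (P : ModuleCat.{0} R) (f : P →ₗ[R] N), FGProj R P →
    Function.Surjective f → Y (ModuleCat.of R (LinearMap.ker f))

lemma ses_of {L M N : ModuleCat.{0} R} {f : L →ₗ[R] M} {g : M →ₗ[R] N}
    (hf : Function.Injective f) (hg : Function.Surjective g) (h : ∀ x, g x = 0 ↔ ∃ y, f y = x) :
    SES R f g := ⟨hf, hg, by ext x; simp [h]⟩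

/-- splitting of a retract -/
lemma retract_equiv {M N : Type} [AddCommGroup M] [Module R M] [AddCommGroup N] [Module R N]
    (i : N →ₗ[R] M) (l : M →ₗ[R] N) (h : ∀ x, l (i x) = x) :
    Nonempty (M ≃ₗ[R] N × LinearMap.ker l) := by
  refine ⟨LinearEquiv.ofLinearMap
    (l.prod (LinearMap.codRestrict (LinearMap.ker l) (LinearMap.id - i.comp l) ?_))
    (i.coprod (LinearMap.ker l).subtype) ?_ ?_⟩
  · intro x; simp [h]
  · apply LinearMap.ext
    rintro ⟨x, y, hy⟩
    have hy' : l y = 0 := hy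
    ext <;> simp [h, hy']
  · ext x; simp

lemma Resolving.res {X : ModuleCat.{0} R → Prop} (hX : Resolving R X) : Res X where
  fg := hX.fg
  proj := hX.proj
  retract M N i l h hM :=
    hX.summand M N (ModuleCat.of R (LinearMap.ker l)) hM (retract_equiv i l h)
  ext L M N f g hf hg h hL hN := hX.extension L M N f g (ses_of hf hg h) hL hN

variable {Y : ModuleCat.{0} R → Prop}

lemma Res.equiv (hY : Res Y) {M N : ModuleCat.{0} R} (e : M ≃ₗ[R] N) (h : Y M) : Y N :=
  hY.retract M N e.symm.toLinearMap e.toLinearMap (by simp) h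

lemma Res.prod (hY : Res Y) {M N : ModuleCat.{0} R} (hM : Y M) (hN : Y N) :
    Y (ModuleCat.of R (M × N)) :=
  hY.ext M (ModuleCat.of R (M × N)) N (LinearMap.inl R M N) (LinearMap.snd R M N)
    LinearMap.inl_injective LinearMap.snd_surjective
    (by rintro ⟨a, b⟩; simp [eq_comm]) hM hN

lemma Res.schanuel (hY : Res Y) {P N : ModuleCat.{0} R} (f : P →ₗ[R] N) (hP : FGProj R P)
    (hf : Function.Surjective f) (hk : Y (ModuleCat.of R (LinearMap.ker f))) : Suc Y N := by
  have := hP.1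
  have := hP.2
  refine ⟨Module.Finite.of_surjective f hf, fun G g hG hg => ?_⟩
  obtain ⟨s, hs⟩ := Module.projective_lifting_property g f hg
  replace hs : ∀ x, g (s x) = f x := fun x => LinearMap.congr_fun hs x
  have key : Y (ModuleCat.of R (LinearMap.ker g × P)) := by
    refine hY.ext (ModuleCat.of R (LinearMap.ker f)) _ G
      ((LinearMap.codRestrict (LinearMap.ker g) (-(s.comp (LinearMap.ker f).subtype)) ?_).prod
        (LinearMap.ker f).subtype)
      ((LinearMap.ker g).subtype.coprod s) ?_ ?_ ?_ hk (hY.proj _ hG)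
    · rintro ⟨x, hx⟩
      simpa [hs] using hx
    · intro x y hxy
      exact Subtype.ext (congrArg Prod.snd hxy)
    · intro y
      obtain ⟨p, hp⟩ := hf (g y)
      refine ⟨(⟨y - s p, by simp [hs, hp]⟩, p), by simp⟩
    · rintro ⟨⟨a, ha⟩, p⟩
      have ha' : g a = 0 := ha
      constructor
      · intro h
        have h' : a + s p = 0 := by simpa using h
        have hp : f p = 0 := by
          have h2 := congrArg g h'
          rw [map_add, ha', zero_add, hs, map_zero] at h2
          exact h2
        refine ⟨⟨p, hp⟩, ?_⟩
        ext
        · simp [eq_neg_of_add_eq_zero_left h']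
        · simp
      · rintro ⟨⟨q, hq⟩, h⟩
        have h1 : -s q = a := congrArg (fun t => (t.1 : G)) h
        have h2 : q = p := congrArg Prod.snd h
        simp [← h1, ← h2]
  exact hY.retract _ _ (LinearMap.inl R (LinearMap.ker g) P) (LinearMap.fst R _ P) (by simp) key

lemma exists_cover (N : ModuleCat.{0} R) (hN : Module.Finite R N) :
    ∃ (P : ModuleCat.{0} R) (f : P →ₗ[R] N), FGProj R P ∧ Function.Surjective f := by
  obtain ⟨n, f, hf⟩ := Module.Finite.exists_fin' R N
  exact ⟨ModuleCat.of R (Fin n → R), f, ⟨inferInstanceAs (Module.Finite R (Fin n → R)),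
    inferInstanceAs (Module.Projective R (Fin n → R))⟩, hf⟩

lemma FGProj.prod {P Q : ModuleCat.{0} R} (hP : FGProj R P) (hQ : FGProj R Q) :
    FGProj R (ModuleCat.of R (P × Q)) := by
  obtain ⟨_, _⟩ := hP
  obtain ⟨_, _⟩ := hQ
  exact ⟨inferInstanceAs (Module.Finite R (P × Q)), inferInstanceAs (Module.Projective R (P × Q))⟩

lemma Res.suc (hY : Res Y) : Res (Suc Y) where
  fg M h := h.1
  proj M hM := by
    refine hY.schanuel (P := M) LinearMap.id hM Function.surjective_id (hY.proj _ ?_)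
    have : Subsingleton (LinearMap.ker (LinearMap.id : M →ₗ[R] M)) := by
      rw [LinearMap.ker_id]; infer_instance
    exact ⟨inferInstanceAs (Module.Finite R (LinearMap.ker (LinearMap.id : M →ₗ[R] M))),
      inferInstanceAs (Module.Projective R (LinearMap.ker (LinearMap.id : M →ₗ[R] M)))⟩
  retract M N i l h hM := by
    have hMf := hM.1
    have hNf : Module.Finite R N := Module.Finite.of_surjective l fun x => ⟨i x, h x⟩
    refine ⟨hNf, fun P f hP hf => ?_⟩
    obtain ⟨Q, g, hQ, hg⟩ := exists_cover M hMf
    let φ : (P × Q) →ₗ[R] M := (i.comp f).coprod (g - i.comp (l.comp g))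
    have hφ : Function.Surjective φ := by
      intro m
      obtain ⟨q, hq⟩ := hg m
      obtain ⟨p, hp⟩ := hf (l m)
      exact ⟨(p, q), by simp [φ, hq, hp]⟩
    have hlφ : ∀ x, l (φ x) = f x.1 := by
      rintro ⟨p, q⟩; simp [φ, h]
    have h1 := hM.2 (ModuleCat.of R (P × Q)) φ (hP.prod hQ) hφ
    refine hY.retract _ _
      (LinearMap.codRestrict (LinearMap.ker φ) ((LinearMap.inl R P Q).comp (LinearMap.ker f).subtype) ?_)
      (LinearMap.codRestrict (LinearMap.ker f) ((LinearMap.fst R P Q).comp (LinearMap.ker φ).subtype) ?_)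
      ?_ h1
    · rintro ⟨x, hx⟩
      have hx' : f x = 0 := hx
      simp [φ, hx']
    · rintro ⟨x, hx⟩
      have hx' : φ x = 0 := hx
      have := hlφ x
      rw [hx', map_zero] at this
      simpa using this.symm
    · rintro ⟨x, hx⟩
      rfl
  ext A B C f g hf hg h hA hC := by
    obtain ⟨P, p, hP, hp⟩ := exists_cover A hA.1
    obtain ⟨Q, q, hQ, hq⟩ := exists_cover C hC.1
    have := hQ.2
    obtain ⟨s, hs⟩ := Module.projective_lifting_property g q hg
    replace hs : ∀ x, g (s x) = q x := fun x => LinearMap.congr_fun hs x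
    have hgf : ∀ a, g (f a) = 0 := fun a => (h _).2 ⟨a, rfl⟩
    let φ : (P × Q) →ₗ[R] B := (f.comp p).coprod s
    have hgφ : ∀ x, g (φ x) = q x.2 := by
      rintro ⟨a, b⟩; simp [φ, hgf, hs]
    have hφ : Function.Surjective φ := by
      intro b
      obtain ⟨y, hy⟩ := hq (g b)
      obtain ⟨a, ha⟩ := (h (b - s y)).1 (by simp [hs, hy])
      obtain ⟨x, hx⟩ := hp a
      exact ⟨(x, y), by simp [φ, hx, ha]⟩
    refine hY.schanuel (P := ModuleCat.of R (P × Q)) φ (hP.prod hQ) hφ ?_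
    refine hY.ext (ModuleCat.of R (LinearMap.ker p)) _ (ModuleCat.of R (LinearMap.ker q))
      (LinearMap.codRestrict (LinearMap.ker φ) ((LinearMap.inl R P Q).comp (LinearMap.ker p).subtype) ?_)
      (LinearMap.codRestrict (LinearMap.ker q) ((LinearMap.snd R P Q).comp (LinearMap.ker φ).subtype) ?_)
      ?_ ?_ ?_ (hA.2 P p hP hp) (hC.2 Q q hQ hq)
    · rintro ⟨x, hx⟩
      have hx' : p x = 0 := hx
      simp [φ, hx']
    · rintro ⟨x, hx⟩
      have hx' : φ x = 0 := hx
      have := hgφ x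
      rw [hx', map_zero] at this
      simpa using this.symm
    · intro x y hxy
      apply Subtype.ext
      exact congrArg (fun t => (t.1 : P × Q).1) hxy
    · rintro ⟨y, hy⟩
      have hy' : q y = 0 := hy
      obtain ⟨a, ha⟩ := (h (s y)).1 (by rw [hs, hy'])
      obtain ⟨x, hx⟩ := hp a
      exact ⟨⟨(-x, y), by simp [φ, hx, ha]⟩, rfl⟩
    · rintro ⟨⟨x, y⟩, hxy⟩
      have hxy' : f (p x) + s y = 0 := by simpa [φ] using hxy
      constructor
      · intro h0
        have hy : y = 0 := congrArg Subtype.val h0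
        subst hy
        rw [map_zero, add_zero] at hxy'
        have hx : p x = 0 := hf (by rw [hxy', map_zero])
        exact ⟨⟨x, hx⟩, rfl⟩
      · rintro ⟨⟨z, hz⟩, h0⟩
        have : (0 : Q) = y := congrArg (fun t => (t.1 : P × Q).2) h0
        exact Subtype.ext this.symm

lemma Suc.mono {Z : ModuleCat.{0} R → Prop} (h : ∀ M, Y M → Z M) {M : ModuleCat.{0} R}
    (hM : Suc Y M) : Suc Z M := ⟨hM.1, fun P f hP hf => h _ (hM.2 P f hP hf)⟩

lemma Res.coker (hY : Res Y) {A B C : ModuleCat.{0} R} (f : A →ₗ[R] B) (g : B →ₗ[R] C)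
    (hf : Function.Injective f) (hg : Function.Surjective g) (h : ∀ x, g x = 0 ↔ ∃ y, f y = x)
    (hA : Y A) (hB : Suc Y B) : Suc Y C := by
  obtain ⟨P, p, hP, hp⟩ := exists_cover B hB.1
  refine hY.schanuel (g.comp p) hP (hg.comp hp) ?_
  have hgf : ∀ a, g (f a) = 0 := fun a => (h _).2 ⟨a, rfl⟩
  -- the equivalence of `A` with the range of `f`
  let e : A ≃ₗ[R] LinearMap.range f := LinearEquiv.ofInjective f hf
  have he : ∀ b, f (e.symm b) = b := fun b => by
    have := LinearEquiv.apply_symm_apply e b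
    exact congrArg Subtype.val this
  refine hY.ext (ModuleCat.of R (LinearMap.ker p)) _ A
    (LinearMap.codRestrict (LinearMap.ker (g.comp p)) (LinearMap.ker p).subtype ?_)
    (e.symm.toLinearMap.comp
      (LinearMap.codRestrict (LinearMap.range f) (p.comp (LinearMap.ker (g.comp p)).subtype) ?_))
    ?_ ?_ ?_ (hB.2 P p hP hp) hA
  · rintro ⟨x, hx⟩
    have hx' : p x = 0 := hx
    simp [hx']
  · rintro ⟨x, hx⟩
    exact (h _).1 hx
  · intro x y hxy
    exact Subtype.ext (congrArg (fun t => (t.1 : P)) hxy)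
  · intro a
    obtain ⟨x, hx⟩ := hp (f a)
    refine ⟨⟨x, by simp [hx, hgf]⟩, ?_⟩
    apply hf
    simp [he, hx]
  · rintro ⟨x, hx⟩
    constructor
    · intro h0
      have := congrArg f h0
      have h1 : p x = 0 := by simpa [he] using this
      exact ⟨⟨x, h1⟩, rfl⟩
    · rintro ⟨⟨z, hz⟩, h0⟩
      have h1 : z = x := congrArg Subtype.val h0
      subst h1
      apply hf
      rw [map_zero]
      have hzp : p z = 0 := hz
      simp [he, hzp]

/-- the tower of classes -/
def Tow (X : ModuleCat.{0} R → Prop) : ℕ → ModuleCat.{0} R → Prop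
  | 0 => X
  | n + 1 => Suc (Tow X n)

variable {X : ModuleCat.{0} R → Prop}

lemma Tow.res (hX : Resolving R X) (n : ℕ) : Res (Tow X n) := by
  induction n with
  | zero => exact hX.res
  | succ n ih => exact ih.suc

lemma Tow.succ (hX : Resolving R X) (n : ℕ) {M : ModuleCat.{0} R} (h : Tow X n M) :
    Tow X (n + 1) M := by
  induction n generalizing M with
  | zero =>
    refine ⟨hX.fg _ h, fun P f hP hf => ?_⟩
    exact hX.ker_epi _ P M _ f (ses_ker hf) (hX.proj _ hP) h
  | succ n ih => exact Suc.mono (fun _ => ih) h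

lemma Tow.mono (hX : Resolving R X) {n m : ℕ} (hnm : n ≤ m) {M : ModuleCat.{0} R}
    (h : Tow X n M) : Tow X m M := by
  induction hnm with
  | refl => exact h
  | step _ ih => exact Tow.succ hX _ ih

lemma quot_append (M : Type) [AddCommGroup M] [Module R M] (ys : List R) (x : R) :
    Ideal.ofList (ys ++ [x]) • (⊤ : Submodule R M)
      = Ideal.ofList ys • ⊤ ⊔ x • (⊤ : Submodule R M) := by
  rw [Ideal.ofList_append, Submodule.sup_smul, Ideal.ofList_singleton,
    Submodule.ideal_span_singleton_smul]

lemma quot_le (M : Type) [AddCommGroup M] [Module R M] (ys : List R) (x : R) :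
    Ideal.ofList ys • (⊤ : Submodule R M) ≤ Ideal.ofList (ys ++ [x]) • (⊤ : Submodule R M) := by
  rw [quot_append]; exact le_sup_left

lemma quot_exact (M : Type) [AddCommGroup M] [Module R M] (ys : List R) (x : R)
    (v : M ⧸ (Ideal.ofList ys • (⊤ : Submodule R M))) :
    Submodule.factor (quot_le M ys x) v = 0 ↔ ∃ w, x • w = v := by
  obtain ⟨v, rfl⟩ := Submodule.Quotient.mk_surjective _ v
  constructor
  · intro h
    have h' : v ∈ Ideal.ofList (ys ++ [x]) • (⊤ : Submodule R M) := by
      simpa [Submodule.Quotient.mk_eq_zero] using h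
    rw [quot_append, Submodule.mem_sup] at h'
    obtain ⟨a, ha, b, hb, rfl⟩ := h'
    obtain ⟨c, -, rfl⟩ := (Submodule.mem_smul_pointwise_iff_exists _ _ _).1 hb
    refine ⟨Submodule.Quotient.mk c, ?_⟩
    rw [Submodule.Quotient.mk_add, (Submodule.Quotient.mk_eq_zero _).2 ha, zero_add]
    rfl
  · rintro ⟨w, hw⟩
    rw [← hw, map_smul]
    obtain ⟨w, rfl⟩ := Submodule.Quotient.mk_surjective _ w
    change Submodule.Quotient.mk (x • w) = _
    rw [Submodule.Quotient.mk_eq_zero, quot_append]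
    exact Submodule.mem_sup_right (Submodule.smul_mem_pointwise_smul _ _ _ Submodule.mem_top)

/-- quotients by weakly regular sequences -/
abbrev Qt (M : Type) [AddCommGroup M] [Module R M] (ys : List R) : Type :=
  M ⧸ (Ideal.ofList ys • (⊤ : Submodule R M))

lemma wreg_append_singleton {M : Type} [AddCommGroup M] [Module R M] {ys : List R} {x : R} :
    RingTheory.Sequence.IsWeaklyRegular M (ys ++ [x]) ↔
      RingTheory.Sequence.IsWeaklyRegular M ys ∧ IsSMulRegular (Qt M ys) x := by
  rw [RingTheory.Sequence.isWeaklyRegular_append_iff,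
    RingTheory.Sequence.isWeaklyRegular_singleton_iff]

lemma Tow.quot (hX : Resolving R X) {M : ModuleCat.{0} R} (hM : X M) (ys : List R)
    (h : RingTheory.Sequence.IsWeaklyRegular M ys) :
    Tow X ys.length (ModuleCat.of R (Qt M ys)) := by
  induction ys using List.reverseRecOn with
  | nil =>
    refine hX.res.equiv (M := M) (N := ModuleCat.of R (Qt M ([] : List R))) ?_ hM
    exact (Submodule.quotEquivOfEqBot _ (by simp)).symm
  | append_singleton ys x ih =>
    rw [wreg_append_singleton] at h
    have h1 := ih h.1
    rw [List.length_append, List.length_singleton]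
    exact (Tow.res hX ys.length).coker (A := ModuleCat.of R (Qt M ys)) (B := ModuleCat.of R (Qt M ys))
      (C := ModuleCat.of R (Qt M (ys ++ [x])))
      (LinearMap.lsmul R (Qt M ys) x) (Submodule.factor (quot_le M ys x)) h.2
      (Submodule.factor_surjective _) (quot_exact M ys x) h1 (Tow.succ hX _ h1)

end C
end Paper

namespace Paper

section E
set_option linter.unusedSectionVars false
variable {R : Type} [CommRing R] [IsLocalRing R]

/-- the residue field as a module -/
abbrev kk (R : Type) [CommRing R] [IsLocalRing R] : ModuleCat.{0} R :=
  ModuleCat.of R (R ⧸ IsLocalRing.maximalIdeal R)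

lemma torsion_equiv (N : Type) [AddCommGroup N] [Module R N] [Module.Finite R N]
    (h : ∀ a ∈ IsLocalRing.maximalIdeal R, ∀ v : N, a • v = 0) :
    ∃ r : ℕ, Nonempty (N ≃ₗ[R] (Fin r → R ⧸ IsLocalRing.maximalIdeal R)) := by
  let _ : Field (R ⧸ IsLocalRing.maximalIdeal R) := Ideal.Quotient.field _
  have ht : Module.IsTorsionBySet R N (IsLocalRing.maximalIdeal R : Set R) := fun v a => h a a.2 v
  let _ := ht.module
  have : IsScalarTower R (R ⧸ IsLocalRing.maximalIdeal R) N := ht.isScalarTower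
  have : Module.Finite (R ⧸ IsLocalRing.maximalIdeal R) N := Module.Finite.of_restrictScalars_finite R _ _
  let b := Module.finBasis (R ⧸ IsLocalRing.maximalIdeal R) N
  exact ⟨_, ⟨(b.equivFun).restrictScalars R⟩⟩

lemma fgproj_subsingleton (N : ModuleCat.{0} R) [Subsingleton N] : FGProj R N :=
  ⟨inferInstance, inferInstance⟩

variable {Y : ModuleCat.{0} R → Prop}

lemma Res.pow (hY : Res Y) {M : ModuleCat.{0} R} (hM : Y M) (r : ℕ) :
    Y (ModuleCat.of R (Fin r → M)) := by
  induction r with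
  | zero =>
    apply hY.proj
    have : Subsingleton (ModuleCat.of R (Fin 0 → M)) := inferInstanceAs (Subsingleton (Fin 0 → M))
    exact fgproj_subsingleton _
  | succ r ih =>
    exact hY.equiv (Fin.consLinearEquiv R (fun _ => (M : Type))) (hY.prod hM ih)

lemma Res.torsion (hY : Res Y) (hk : Y (kk R)) (N : Type) [AddCommGroup N] [Module R N]
    [Module.Finite R N]
    (h : ∀ a ∈ IsLocalRing.maximalIdeal R, ∀ v : N, a • v = 0) : Y (ModuleCat.of R N) := by
  obtain ⟨r, ⟨e⟩⟩ := torsion_equiv N h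
  exact hY.equiv (M := ModuleCat.of R (Fin r → kk R)) e.symm (hY.pow hk r)

/-- a submodule element killing -/
lemma quot_torsion (I : Ideal R) (N : Type) [AddCommGroup N] [Module R N] (a : R) (ha : a ∈ I)
    (v : N ⧸ (I • (⊤ : Submodule R N))) : a • v = 0 := by
  obtain ⟨v, rfl⟩ := Submodule.Quotient.mk_surjective _ v
  rw [← Submodule.Quotient.mk_smul, Submodule.Quotient.mk_eq_zero]
  exact Submodule.smul_mem_smul ha Submodule.mem_top

lemma Res.socle_zero (hY : Res Y) (B : ModuleCat.{0} R) (hB : Y B) (s : B)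
    (hs : ∀ a ∈ IsLocalRing.maximalIdeal R, a • s = 0)
    (hs' : s ∉ IsLocalRing.maximalIdeal R • (⊤ : Submodule R B)) : Y (kk R) := by
  have := hY.fg B hB
  let _ : Field (R ⧸ IsLocalRing.maximalIdeal R) := Ideal.Quotient.field _
  obtain ⟨r, ⟨e⟩⟩ := torsion_equiv (B ⧸ (IsLocalRing.maximalIdeal R • (⊤ : Submodule R B)))
    (quot_torsion _ B)
  have hne : e (Submodule.Quotient.mk s) ≠ 0 := by
    intro h
    rw [map_eq_zero_iff _ e.injective, Submodule.Quotient.mk_eq_zero] at h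
    exact hs' h
  obtain ⟨i, hi⟩ := Function.ne_iff.1 hne
  let φ : B →ₗ[R] (R ⧸ IsLocalRing.maximalIdeal R) :=
    LinearMap.proj i ∘ₗ e.toLinearMap ∘ₗ Submodule.mkQ _
  have hφ : φ s ≠ 0 := hi
  refine hY.retract B (kk R)
    (Submodule.liftQ (IsLocalRing.maximalIdeal R) (LinearMap.toSpanSingleton R B s) ?_)
    ((LinearMap.mulLeft R (φ s)⁻¹) ∘ₗ φ) ?_ hB
  · intro a ha
    rw [LinearMap.mem_ker, LinearMap.toSpanSingleton_apply]; exact hs a ha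
  · intro x
    obtain ⟨x, rfl⟩ := Ideal.Quotient.mk_surjective x
    have : (Submodule.liftQ (IsLocalRing.maximalIdeal R) (LinearMap.toSpanSingleton R B s) (by
      intro a ha
      rw [LinearMap.mem_ker, LinearMap.toSpanSingleton_apply]
      exact hs a ha)) (Ideal.Quotient.mk (IsLocalRing.maximalIdeal R) x) = x • s := rfl
    rw [LinearMap.comp_apply, this, map_smul, map_smul, LinearMap.mulLeft_apply, inv_mul_cancel₀ hφ]
    rw [Algebra.smul_def, mul_one]; rfl

lemma Res.kk_of_torsion (hY : Res Y) (N : ModuleCat.{0} R) (hN : Y N) (hne : ¬ Subsingleton N)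
    (h : ∀ a ∈ IsLocalRing.maximalIdeal R, ∀ v : N, a • v = 0) : Y (kk R) := by
  rw [not_subsingleton_iff_nontrivial] at hne
  obtain ⟨s, hs⟩ := exists_ne (0 : N)
  refine hY.socle_zero N hN s (fun a ha => h a ha s) ?_
  have : IsLocalRing.maximalIdeal R • (⊤ : Submodule R N) = ⊥ := by
    rw [eq_bot_iff, Submodule.smul_le]
    intro a ha v _
    rw [Submodule.mem_bot]; exact h a ha v
  rw [this]; simpa using hs

lemma Res.socle_step (hY : Res Y) (hk : Suc Y (kk R)) (c : ℕ) (B : ModuleCat.{0} R) (hB : Y B)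
    (s : B) (hs : ∀ a ∈ IsLocalRing.maximalIdeal R, a • s = 0)
    (hs' : s ∉ (IsLocalRing.maximalIdeal R) ^ (c + 1) • (⊤ : Submodule R B)) : Y (kk R) := by
  induction c generalizing B with
  | zero => exact hY.socle_zero B hB s hs (by simpa using hs')
  | succ c ih =>
    have := hY.fg B hB
    set m := IsLocalRing.maximalIdeal R
    obtain ⟨F, p, hF, hp⟩ := exists_cover B (hY.fg B hB)
    let q := Submodule.mkQ (m • (⊤ : Submodule R B))
    have hq : Function.Surjective q := Submodule.mkQ_surjective _
    have hK : Suc Y (ModuleCat.of R (B ⧸ (m • (⊤ : Submodule R B)))) :=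
      hY.suc.torsion hk _ (quot_torsion _ B)
    have hker := hK.2 F (q.comp p) hF (hq.comp hp)
    let ψ : (B × F) →ₗ[R] B := LinearMap.fst R B F - p.comp (LinearMap.snd R B F)
    let E := LinearMap.ker (q.comp ψ)
    have hE : Y (ModuleCat.of R E) := by
      refine hY.ext (ModuleCat.of R (LinearMap.ker (q.comp p))) _ B
        (LinearMap.codRestrict E ((LinearMap.inr R B F).comp (LinearMap.ker (q.comp p)).subtype) ?_)
        ((LinearMap.fst R B F).comp E.subtype) ?_ ?_ ?_ hker hB
      · rintro ⟨x, hx⟩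
        have hx' : q (p x) = 0 := hx
        simp [E, ψ, hx']
      · intro x y hxy
        exact Subtype.ext (congrArg (fun t => (t.1 : B × F).2) hxy)
      · intro b
        obtain ⟨x, hx⟩ := hp b
        exact ⟨⟨(b, x), by simp [E, ψ, hx]⟩, rfl⟩
      · rintro ⟨⟨b, x⟩, hbx⟩
        have hbx' : q b - q (p x) = 0 := by simpa [E, ψ] using hbx
        constructor
        · intro h0
          have h1 : b = 0 := h0
          subst h1
          refine ⟨⟨x, ?_⟩, rfl⟩
          simpa using hbx'
        · rintro ⟨⟨z, hz⟩, h0⟩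
          exact (congrArg (fun t => (t.1 : B × F).1) h0).symm
    by_cases hsm : s ∈ m • (⊤ : Submodule R B)
    swap
    · exact hY.socle_zero B hB s hs hsm
    have hqs : q s = 0 := by
      rw [Submodule.mkQ_apply, Submodule.Quotient.mk_eq_zero]; exact hsm
    refine ih (ModuleCat.of R E) hE ⟨(s, 0), by simp [E, ψ, hqs]⟩ ?_ ?_
    · intro a ha
      apply Subtype.ext
      change a • (s, (0 : F)) = 0
      rw [Prod.smul_mk, hs a ha, smul_zero]; rfl
    · intro hmem
      apply hs'
      have h1 := Submodule.mem_map_of_mem (f := ψ.comp E.subtype) hmem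
      rw [Submodule.map_smul''] at h1
      have h2 : (ψ.comp E.subtype) ⟨(s, 0), by simp [E, ψ, hqs]⟩ = s := by simp [ψ]
      have h3 : Submodule.map (ψ.comp E.subtype) ⊤ ≤ m • (⊤ : Submodule R B) := by
        rw [Submodule.map_le_iff_le_comap]
        rintro ⟨x, hx⟩ _
        have hx' : q (ψ x) = 0 := hx
        rwa [Submodule.mkQ_apply, Submodule.Quotient.mk_eq_zero] at hx'
      have h4 := Submodule.smul_mono (le_refl (m ^ (c + 1))) h3 h1
      rw [pow_succ, mul_smul]
      exact h2 ▸ h4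

lemma Res.socle [IsNoetherianRing R] (hY : Res Y) (hk : Suc Y (kk R)) (B : ModuleCat.{0} R) (hB : Y B)
    (s : B) (hs : ∀ a ∈ IsLocalRing.maximalIdeal R, a • s = 0) (hs0 : s ≠ 0) : Y (kk R) := by
  have := hY.fg B hB
  have hK := Ideal.iInf_pow_smul_eq_bot_of_isLocalRing (M := B) (IsLocalRing.maximalIdeal R)
    (Ideal.IsPrime.ne_top inferInstance)
  have : s ∉ (⨅ i : ℕ, IsLocalRing.maximalIdeal R ^ i • ⊤ : Submodule R B) := by
    rw [hK]; exact fun h => hs0 ((Submodule.mem_bot R).1 h)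
  rw [Submodule.mem_iInf, not_forall] at this
  obtain ⟨c, hc⟩ := this
  refine hY.socle_step hk c B hB s hs fun h => hc ?_
  exact Submodule.smul_mono_left (Ideal.pow_le_pow_right (Nat.le_succ c)) h

lemma Res.finlen [IsNoetherianRing R] (hY : Res Y) (hk : Y (kk R)) (c : ℕ) (N : Type)
    [AddCommGroup N] [Module R N] [Module.Finite R N]
    (h : IsLocalRing.maximalIdeal R ^ c • (⊤ : Submodule R N) = ⊥) : Y (ModuleCat.of R N) := by
  induction c generalizing N with
  | zero =>
    rw [pow_zero, Ideal.one_eq_top, Submodule.top_smul] at h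
    have : Subsingleton (ModuleCat.of R N) := (Submodule.subsingleton_iff R).1 (subsingleton_of_top_eq_bot h) 
    exact hY.proj _ (fgproj_subsingleton _)
  | succ c ih =>
    set m := IsLocalRing.maximalIdeal R
    refine hY.ext (ModuleCat.of R (m • (⊤ : Submodule R N) : Submodule R N)) _
      (ModuleCat.of R (N ⧸ (m • (⊤ : Submodule R N)))) (Submodule.subtype _) (Submodule.mkQ _)
      Subtype.val_injective (Submodule.mkQ_surjective _) ?_ (ih _ ?_)
      (hY.torsion hk _ (quot_torsion _ N))
    · intro x
      simp
    · apply Submodule.map_injective_of_injective (Submodule.injective_subtype (m • (⊤ : Submodule R N)))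
      rw [Submodule.map_smul'', Submodule.map_bot, Submodule.map_top, Submodule.range_subtype,
        ← mul_smul, ← pow_succ, h]

end E
end Paper

namespace Paper

section F
set_option linter.unusedSectionVars false
variable {R : Type} [CommRing R] [IsLocalRing R] [IsNoetherianRing R]

lemma avoid (E₁ E₂ : Type) [AddCommGroup E₁] [Module R E₁] [Module.Finite R E₁]
    [AddCommGroup E₂] [Module R E₂] [Module.Finite R E₂]
    (h : IsLocalRing.maximalIdeal R ∉ associatedPrimes R E₁) :
    ∃ x ∈ IsLocalRing.maximalIdeal R, IsSMulRegular E₁ x ∧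
      ∀ p ∈ associatedPrimes R E₂, x ∈ p → p = IsLocalRing.maximalIdeal R := by
  set m := IsLocalRing.maximalIdeal R
  let S : Set (Ideal R) := associatedPrimes R E₁ ∪ (associatedPrimes R E₂ \ {m})
  have hS : S.Finite := (associatedPrimes.finite R E₁).union ((associatedPrimes.finite R E₂).subset
    Set.sdiff_subset)
  have hprime : ∀ p ∈ S, p.IsPrime := by
    rintro p (hp | ⟨hp, -⟩) <;> exact hp.isPrime
  have hnot : ¬ ((m : Set R) ⊆ ⋃ p ∈ S, (p : Set R)) := by
    rw [Ideal.subset_union_prime_finite (f := fun p => p) hS ⊤ ⊤ (fun p hp _ _ => hprime p hp)]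
    rintro ⟨p, hp, hmp⟩
    have : m = p := (IsLocalRing.maximalIdeal.isMaximal R).eq_of_le (hprime p hp).ne_top hmp
    rcases hp with hp | ⟨-, hp⟩
    · exact h (this ▸ hp)
    · exact hp this.symm
  obtain ⟨x, hxm, hx⟩ := Set.not_subset.1 hnot
  refine ⟨x, hxm, ?_, ?_⟩
  · by_contra hreg
    have : x ∈ ⋃ p ∈ associatedPrimes R E₁, (p : Set R) := by
      rw [biUnion_associatedPrimes_eq_compl_regular]; exact hreg
    simp only [Set.mem_iUnion] at this hx
    obtain ⟨p, hp, hxp⟩ := this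
    exact hx ⟨p, Or.inl hp, hxp⟩
  · intro p hp hxp
    by_contra hne
    simp only [Set.mem_iUnion] at hx
    exact hx ⟨p, Or.inr ⟨hp, hne⟩, hxp⟩

lemma torsion_pow (E : Type) [AddCommGroup E] [Module R E] [Module.Finite R E] (x z : R)
    (hx : ∀ p ∈ associatedPrimes R E, x ∈ p → p = IsLocalRing.maximalIdeal R)
    (hz : z ∈ IsLocalRing.maximalIdeal R) : ∃ N : ℕ, ∀ v : E, x • v = 0 → z ^ N • v = 0 := by
  let T := LinearMap.ker (LinearMap.lsmul R E x)
  have hT : ∀ v : T, x • v = 0 := fun v => Subtype.ext v.2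
  have hzr : z ∈ (Module.annihilator R T).radical := by
    rw [← Ideal.sInf_minimalPrimes, Ideal.mem_sInf]
    intro p hp
    have hp' := Module.associatedPrimes.minimalPrimes_annihilator_subset_associatedPrimes R T hp
    have hxp : x ∈ p := hp.1.2 (Module.mem_annihilator.2 hT)
    rw [hx p (associatedPrimes.subset_of_injective T.injective_subtype hp') hxp]
    exact hz
  obtain ⟨N, hN⟩ := hzr
  refine ⟨N, fun v hv => ?_⟩
  exact congrArg Subtype.val (Module.mem_annihilator.1 hN ⟨v, hv⟩)

lemma power_torsion (E : Type) [AddCommGroup E] [Module R E] [Module.Finite R E] (z : R) :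
    ∃ N : ℕ, ∀ (n : ℕ) (v : E), z ^ n • v = 0 → z ^ N • v = 0 := by
  let K : ℕ →o Submodule R E := ⟨fun n => LinearMap.ker (LinearMap.lsmul R E (z ^ n)), by
    intro a b hab v hv
    have hv' : z ^ a • v = 0 := hv
    obtain ⟨c, rfl⟩ := Nat.exists_eq_add_of_le hab
    change z ^ (a + c) • v = 0
    rw [add_comm, pow_add, mul_smul, hv', smul_zero]⟩
  obtain ⟨N, hN⟩ := monotone_stabilizes_iff_noetherian.2 (inferInstanceAs (IsNoetherian R E)) K
  refine ⟨N, fun n v hv => ?_⟩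
  have h1 : v ∈ K (max N n) := K.monotone (le_max_right N n) hv
  rw [← hN _ (le_max_left N n)] at h1
  exact h1

lemma ext_quot {A Q C : ModuleCat.{0} R} (x : R) (g : A →ₗ[R] Q)
    (hx : IsSMulRegular A x) (hg : Function.Surjective g) (h : ∀ v, g v = 0 ↔ ∃ w : A, x • w = v)
    (a b : R) (i : ℕ) (ha : ∀ e : Abelian.Ext A C i, x • e = 0 → a • e = 0)
    (hb : ∀ j, j + 1 = i → ∀ e : Abelian.Ext A C j, b • e = 0) (e : Abelian.Ext Q C i) :
    (b * a) • e = 0 := by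
  obtain ⟨w, hS⟩ := (ses_of (f := LinearMap.lsmul R A x) (g := g) hx hg h).shortComplex
  have hf : (ModuleCat.ofHom (LinearMap.lsmul R A x) : A ⟶ A) = x • 𝟙 A := rfl
  have h1 : (Abelian.Ext.mk₀ (ModuleCat.ofHom g)).comp (a • e) (zero_add i) = 0 := by
    rw [Abelian.Ext.comp_smul]
    apply ha
    have h2 : (Abelian.Ext.mk₀ (ModuleCat.ofHom (LinearMap.lsmul R A x))).comp
        ((Abelian.Ext.mk₀ (ModuleCat.ofHom g)).comp e (zero_add i)) (zero_add i) = 0 := by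
      rw [← Abelian.Ext.comp_assoc_of_second_deg_zero, Abelian.Ext.mk₀_comp_mk₀, w,
        Abelian.Ext.mk₀_zero, Abelian.Ext.zero_comp]
    rwa [hf, Abelian.Ext.mk₀_smul, Abelian.Ext.smul_comp, Abelian.Ext.mk₀_id_comp] at h2
  rcases i with _ | i
  · have := hS.epi_g
    have h2 := Abelian.Ext.precomp_mk₀_injective_of_epi C (ModuleCat.ofHom g) (hg := this)
    have h3 : a • e = 0 := h2 (by simpa using h1)
    rw [mul_smul, h3, smul_zero]
  · obtain ⟨y, hy⟩ := Abelian.Ext.contravariant_sequence_exact₃ hS C (a • e) h1 (add_comm 1 i)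
    rw [mul_smul, ← hy, ← Abelian.Ext.comp_smul, hb i rfl y, Abelian.Ext.comp_zero]

lemma kills_coker {Q A B : ModuleCat.{0} R} {n : ℕ} (x : R) (g : A →ₗ[R] B)
    (hx : IsSMulRegular A x) (hg : Function.Surjective g) (h : ∀ v, g v = 0 ↔ ∃ w : A, x • w = v)
    (hA : Kills Q (1 : R) (n + 1) A) : Kills Q (1 : R) n B := by
  obtain ⟨w, hS⟩ := (ses_of (f := LinearMap.lsmul R A x) (g := g) hx hg h).shortComplex
  intro i hi e
  obtain ⟨y, hy⟩ := Abelian.Ext.covariant_sequence_exact₃ Q hS e (n₁ := i + 1) rfl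
    (by have := hA (i + 1) (by omega) (e.comp hS.extClass rfl); rwa [one_smul] at this)
  have := hA i (by omega) y
  rw [one_smul] at this
  rw [← hy, this, Abelian.Ext.zero_comp, smul_zero]

lemma kills_vanish (Q : ModuleCat.{0} R) [Module.Finite R Q] (rs : List R)
    (hrs : ∀ r ∈ rs, r ∈ IsLocalRing.maximalIdeal R)
    (hreg : RingTheory.Sequence.IsWeaklyRegular R rs) (hQ : ∀ r ∈ rs, ∀ v : Q, r • v = 0) :
    Kills Q (1 : R) rs.length (ModuleCat.of R R) := by
  have hle : Ideal.ofList rs ≤ IsLocalRing.maximalIdeal R := Ideal.span_le.2 hrs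
  have h1 := ModuleCat.subsingleton_ext_of_exists_isRegular (Ideal.ofList rs) Q (by
      rw [Module.support_eq_zeroLocus]
      apply PrimeSpectrum.zeroLocus_anti_mono
      apply Ideal.span_le.2
      intro r hr
      exact Module.mem_annihilator.2 (hQ r hr)) (ModuleCat.of R R) (by
      rw [lt_top_iff_ne_top]
      intro h
      have h2 : Ideal.ofList rs • (⊤ : Ideal R) = ⊤ := h
      rw [smul_eq_mul, Ideal.mul_top] at h2
      rw [h2] at hle
      exact (IsLocalRing.maximalIdeal.isMaximal R).ne_top (top_le_iff.1 hle)) rs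
    (fun r hr => Ideal.subset_span hr)
    ((IsLocalRing.isRegular_iff_isWeaklyRegular_of_subset_maximalIdeal hrs).2 hreg)
  intro i hi e
  have := h1 i hi
  exact Subsingleton.elim _ _

lemma not_ass {E : ModuleCat.{0} R} (h : Kills (kk R) (1 : R) 1 E) :
    IsLocalRing.maximalIdeal R ∉ associatedPrimes R E := by
  intro hm
  rw [AssociatedPrimes.mem_iff, isAssociatedPrime_iff_exists_injective_linearMap] at hm
  obtain ⟨hp, f, hf⟩ := hm
  have h1 := h 0 one_pos (Abelian.Ext.mk₀ (ModuleCat.ofHom f : kk R ⟶ E))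
  rw [one_smul, Abelian.Ext.mk₀_eq_zero_iff] at h1
  have h2 : f = 0 := congrArg ModuleCat.Hom.hom h1
  have h3 : (1 : R ⧸ IsLocalRing.maximalIdeal R) = 0 := hf (by rw [h2]; rfl)
  have : Nontrivial (R ⧸ IsLocalRing.maximalIdeal R) := Ideal.Quotient.nontrivial_iff.2 hp.ne_top
  exact one_ne_zero h3

lemma kills_quot {Q : ModuleCat.{0} R} {n : ℕ} (M : ModuleCat.{0} R) (ys : List R)
    (hys : RingTheory.Sequence.IsWeaklyRegular M ys) (hM : Kills Q (1 : R) (ys.length + n) M) :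
    Kills Q (1 : R) n (ModuleCat.of R (Qt M ys)) := by
  induction ys using List.reverseRecOn generalizing n with
  | nil =>
    refine Kills.equiv (M := ModuleCat.of R (Qt M ([] : List R))) (N := M) ?_ (by simpa using hM)
    exact (Submodule.quotEquivOfEqBot _ (by simp))
  | append_singleton ys x ih =>
    rw [wreg_append_singleton] at hys
    refine kills_coker (A := ModuleCat.of R (Qt M ys)) x (Submodule.factor (quot_le M ys x)) hys.2
      (Submodule.factor_surjective _) (quot_exact M ys x) (ih hys.1 ?_)
    convert hM using 1
    simp; ring

lemma depth_not_ass {e : ℕ} (hCM : DepthGE R R (e + 1)) (ys : List R) (hlen : ys.length ≤ e)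
    (hys : RingTheory.Sequence.IsWeaklyRegular R ys) :
    IsLocalRing.maximalIdeal R ∉ associatedPrimes R (Qt R ys) := by
  obtain ⟨rs, hl, hm, hr⟩ := hCM
  have h1 := kills_vanish (kk R) rs hm hr (by
    intro r hr v
    obtain ⟨v, rfl⟩ := Ideal.Quotient.mk_surjective v
    change Ideal.Quotient.mk _ (r * v) = 0
    exact Ideal.Quotient.eq_zero_iff_mem.2 (Ideal.mul_mem_right _ _ (hm r hr)))
  refine not_ass (E := ModuleCat.of R (Qt R ys)) (kills_quot (ModuleCat.of R R) ys hys ?_)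
  intro i hi
  exact h1 i (by omega)

lemma exists_ys {e : ℕ} (hCM : DepthGE R R (e + 1)) (C : ModuleCat.{0} R) [Module.Finite R C]
    (j : ℕ) (hj : j ≤ e) :
    ∃ ys : List R, ys.length = j ∧ (∀ y ∈ ys, y ∈ IsLocalRing.maximalIdeal R) ∧
      RingTheory.Sequence.IsWeaklyRegular R ys ∧
      ∀ i < j, ∀ z ∈ IsLocalRing.maximalIdeal R, ∃ N : ℕ,
        ∀ v : Abelian.Ext (ModuleCat.of R (Qt R ys)) C i, z ^ N • v = 0 := by
  induction j with
  | zero => exact ⟨[], rfl, by simp, by simp, by simp⟩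
  | succ j ih =>
    obtain ⟨ys, hl, hm, hreg, hN⟩ := ih (by omega)
    have : Module.Finite R (ModuleCat.of R (Qt R ys)) := inferInstanceAs (Module.Finite R (Qt R ys))
    obtain ⟨x, hxm, hxr, hxp⟩ := avoid (Qt R ys) (Abelian.Ext (ModuleCat.of R (Qt R ys)) C j)
      (depth_not_ass hCM ys (by omega) hreg)
    refine ⟨ys ++ [x], by simp [hl], ?_, wreg_append_singleton.2 ⟨hreg, hxr⟩, ?_⟩
    · intro y hy
      rcases List.mem_append.1 hy with hy | hy
      · exact hm y hy
      · rw [List.mem_singleton.1 hy]; exact hxm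
    · intro i hi z hz
      have h1 : ∃ N : ℕ, ∀ v : Abelian.Ext (ModuleCat.of R (Qt R ys)) C i, x • v = 0 → z ^ N • v = 0 := by
        rcases Nat.lt_succ_iff_lt_or_eq.1 hi with hi | rfl
        · obtain ⟨N, hN⟩ := hN i hi z hz
          exact ⟨N, fun v _ => hN v⟩
        · exact torsion_pow _ x z hxp hz
      have h2 : ∃ N : ℕ, ∀ k, k + 1 = i → ∀ v : Abelian.Ext (ModuleCat.of R (Qt R ys)) C k, z ^ N • v = 0 := by
        rcases i with _ | i
        · exact ⟨0, fun k hk => by omega⟩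
        · obtain ⟨N, hN⟩ := hN i (by omega) z hz
          refine ⟨N, fun k hk => ?_⟩
          obtain rfl : k = i := by omega
          exact hN
      obtain ⟨N₁, hN₁⟩ := h1
      obtain ⟨N₂, hN₂⟩ := h2
      refine ⟨N₂ + N₁, fun v => ?_⟩
      rw [pow_add]
      exact ext_quot (A := ModuleCat.of R (Qt R ys)) x (Submodule.factor (quot_le R ys x)) hxr
        (Submodule.factor_surjective _) (quot_exact R ys x) _ _ i hN₁ hN₂ v

/-- the key sequence -/
lemma exists_key {e : ℕ} (hCM : DepthGE R R (e + 1)) (C : ModuleCat.{0} R) [Module.Finite R C] :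
    ∃ (ys : List R) (z : R) (N : ℕ), (∀ y ∈ ys, y ∈ IsLocalRing.maximalIdeal R) ∧
      z ∈ IsLocalRing.maximalIdeal R ∧ IsSMulRegular (Qt R ys) z ∧
      ∀ n, 0 < n → Kills (ModuleCat.of R (Qt R (ys ++ [z ^ n]))) (z ^ N) (e + 1) C ∧
        Kills (ModuleCat.of R (Qt R (ys ++ [z ^ n]))) (1 : R) (e + 1) (ModuleCat.of R R) := by
  obtain ⟨ys, hl, hm, hreg, hN⟩ := exists_ys hCM C e le_rfl
  have : Module.Finite R (ModuleCat.of R (Qt R ys)) := inferInstanceAs (Module.Finite R (Qt R ys))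
  obtain ⟨z, hz, hzr, -⟩ := avoid (Qt R ys) (Qt R ys) (depth_not_ass hCM ys hl.le hreg)
  have h1 : ∃ N : ℕ, ∀ i < e, ∀ v : Abelian.Ext (ModuleCat.of R (Qt R ys)) C i, z ^ N • v = 0 := by
    choose! f hf using fun i hi => hN i hi z hz
    refine ⟨∑ i ∈ Finset.range e, f i, fun i hi v => ?_⟩
    rw [← Finset.add_sum_erase _ _ (Finset.mem_range.2 hi), add_comm, pow_add, mul_smul, hf i hi,
      smul_zero]
  obtain ⟨N₁, hN₁⟩ := h1
  obtain ⟨N₂, hN₂⟩ := power_torsion (Abelian.Ext (ModuleCat.of R (Qt R ys)) C e) z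
  refine ⟨ys, z, N₁ + (N₁ + N₂), hm, hz, hzr, fun n hn => ⟨?_, ?_⟩⟩
  · intro i hi v
    rw [pow_add]
    refine ext_quot (A := ModuleCat.of R (Qt R ys)) (z ^ n) (Submodule.factor (quot_le R ys _))
      (hzr.pow n) (Submodule.factor_surjective _) (quot_exact R ys _) _ _ i ?_ ?_ v
    · intro v hv
      rcases Nat.lt_succ_iff_lt_or_eq.1 hi with hi | rfl
      · rw [add_comm, pow_add, mul_smul, hN₁ i hi, smul_zero]
      · rw [pow_add, mul_smul, hN₂ n v hv, smul_zero]
    · intro k hk v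
      exact hN₁ k (by omega) v
  · have := kills_vanish (ModuleCat.of R (Qt R (ys ++ [z ^ n]))) (ys ++ [z ^ n]) (by
      intro y hy
      rcases List.mem_append.1 hy with hy | hy
      · exact hm y hy
      · rw [List.mem_singleton.1 hy]; exact Ideal.pow_mem_of_mem _ hz n hn)
      (wreg_append_singleton.2 ⟨hreg, hzr.pow n⟩)
      (fun r hr v => quot_torsion _ R r (Ideal.subset_span hr) v)
    simpa [hl] using this

end F
end Paper

namespace Paper

section G
set_option linter.unusedSectionVars false
variable {R : Type} [CommRing R] [IsLocalRing R] [IsNoetherianRing R]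

lemma seq_or (M : Type) [AddCommGroup M] [Module R M] [Module.Finite R M] (t : ℕ) :
    DepthGE R M t ∨ ∃ ys : List R, ys.length < t ∧
      RingTheory.Sequence.IsWeaklyRegular M ys ∧
      IsLocalRing.maximalIdeal R ∈ associatedPrimes R (Qt M ys) := by
  induction t with
  | zero => exact Or.inl ⟨[], rfl, by simp, by simp⟩
  | succ t ih =>
    rcases ih with ⟨ys, hl, hm, hr⟩ | ⟨ys, hl, hr, ha⟩
    · by_cases ha : IsLocalRing.maximalIdeal R ∈ associatedPrimes R (Qt M ys)
      · exact Or.inr ⟨ys, by omega, hr, ha⟩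
      · obtain ⟨x, hx, hxr, -⟩ := avoid (Qt M ys) (Qt M ys) ha
        refine Or.inl ⟨ys ++ [x], by simp [hl], ?_, wreg_append_singleton.2 ⟨hr, hxr⟩⟩
        intro y hy
        rcases List.mem_append.1 hy with hy | hy
        · exact hm y hy
        · rw [List.mem_singleton.1 hy]; exact hx
    · exact Or.inr ⟨ys, by omega, hr, ha⟩

lemma tow_kills {X : ModuleCat.{0} R → Prop} {Q : ModuleCat.{0} R} {a : R} {d : ℕ}
    (hR : Kills Q (1 : R) d (ModuleCat.of R R)) (hX : ∀ M, X M → Kills Q a d M)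
    (j : ℕ) (N : ModuleCat.{0} R) (hN : Tow X j N) (i : ℕ) (hi : i + j < d)
    (v : Abelian.Ext Q N i) : a • v = 0 := by
  induction j generalizing N i with
  | zero => exact hX N hN i hi v
  | succ j ih =>
    obtain ⟨P, f, hP, hf⟩ := exists_cover N hN.1
    exact kills_of_ker hf (Kills.proj hP hR) (by omega)
      (fun w => ih _ (hN.2 P f hP hf) (i + 1) (by omega) w) v

lemma pow_ne (ys : List R) (hm : ∀ y ∈ ys, y ∈ IsLocalRing.maximalIdeal R) (z : R)
    (hz : z ∈ IsLocalRing.maximalIdeal R) (hzr : IsSMulRegular (Qt R ys) z) (T : ℕ) :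
    z ^ T • (Submodule.Quotient.mk 1 : Qt R (ys ++ [z ^ (T + 1)])) ≠ 0 := by
  intro h
  have h1 : Submodule.factor (quot_le R ys (z ^ (T + 1)))
      (z ^ T • (Submodule.Quotient.mk 1 : Qt R ys)) = 0 := by
    rw [map_smul]; exact h
  rw [quot_exact] at h1
  obtain ⟨w, hw⟩ := h1
  rw [pow_succ, mul_smul] at hw
  have h2 := hzr.pow T hw
  obtain ⟨w, rfl⟩ := Submodule.Quotient.mk_surjective _ w
  have h3 : z * w - 1 ∈ Ideal.ofList ys • (⊤ : Submodule R R) := by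
    rw [← Submodule.Quotient.eq]; exact h2
  rw [smul_eq_mul, Ideal.mul_top] at h3
  have h4 : z * w - 1 ∈ IsLocalRing.maximalIdeal R := (Ideal.span_le.2 hm : Ideal.ofList ys ≤ _) h3
  have h5 : (1 : R) ∈ IsLocalRing.maximalIdeal R := by
    have := Ideal.sub_mem _ (Ideal.mul_mem_right w _ hz) h4
    simpa using this
  exact (IsLocalRing.maximalIdeal.isMaximal R).ne_top ((Ideal.eq_top_iff_one _).2 h5)

theorem main_aux (d : ℕ) (hCM : DepthGE R R d)
    (X : ModuleCat.{0} R → Prop) (hX : Resolving R X) (hrad : FiniteRadius R X)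
    (U : ModuleCat.{0} R) (hU : X U) (hUl : Ulrich R d U) :
    ∀ M, X M → DepthGE R M d := by
  intro M hM
  rcases d with _ | e
  · exact ⟨[], rfl, by simp, by simp⟩
  have := hX.fg M hM
  rcases seq_or (R := R) M (e + 1) with h | ⟨ys, hl, hr, ha⟩
  · exact h
  exfalso
  -- `k` lies in the `(e+1)`-st class
  have hk1 : Tow X (e + 1) (kk R) := by
    obtain ⟨hfin, -, hne, xs, hxl, hxm, hxr, hx⟩ := hUl
    have h1 := Tow.quot hX hU xs hxr
    rw [hxl] at h1
    refine (Tow.res hX (e + 1)).kk_of_torsion _ h1 ?_ ?_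
    · intro hs
      have hs' : Subsingleton (U ⧸ (Ideal.ofList xs • (⊤ : Submodule R U))) := hs
      rw [Submodule.Quotient.subsingleton_iff, ← hx] at hs'
      apply hne
      have := Submodule.eq_bot_of_le_smul_of_le_jacobson_bot (IsLocalRing.maximalIdeal R)
        (⊤ : Submodule R U) hfin.1 hs'.ge (IsLocalRing.maximalIdeal_le_jacobson _)
      exact (Submodule.subsingleton_iff R).1 (subsingleton_of_bot_eq_top this.symm)
    · intro a ha v
      obtain ⟨v, rfl⟩ := Submodule.Quotient.mk_surjective _ v
      change Submodule.Quotient.mk (a • v) = 0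
      rw [Submodule.Quotient.mk_eq_zero, ← hx]
      exact Submodule.smul_mem_smul ha Submodule.mem_top
  -- `k` lies in the `e`-th class
  have hk : Tow X e (kk R) := by
    rw [AssociatedPrimes.mem_iff, isAssociatedPrime_iff] at ha
    obtain ⟨hp, s, hs⟩ := ha
    refine (Tow.res hX e).socle hk1 (ModuleCat.of R (Qt M ys))
      (Tow.mono hX (by omega) (Tow.quot hX hM ys hr)) s ?_ ?_
    · intro a ha
      rw [hs, Submodule.mem_colon_singleton, Submodule.mem_bot] at ha
      exact ha
    · rintro rfl
      apply hp.ne_top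
      rw [hs]
      simp
  obtain ⟨C, n, hC, hball⟩ := hrad
  have := hX.fg C hC
  obtain ⟨ys, z, N, hm, hz, hzr, hkey⟩ := exists_key hCM C
  set T := N * (n + 1) with hT
  obtain ⟨hQC, hQR⟩ := hkey (T + 1) (Nat.succ_pos T)
  have hkill : ∀ M, X M → Kills (ModuleCat.of R (Qt R (ys ++ [z ^ (T + 1)]))) (z ^ T) (e + 1) M := by
    intro M hM
    have := Kills.ball hQR hQC n (hball M hM)
    rwa [← pow_mul] at this
  have hne := pow_ne ys hm z hz hzr T
  set w := z ^ T • (Submodule.Quotient.mk 1 : Qt R (ys ++ [z ^ (T + 1)])) with hw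
  have hK := Ideal.iInf_pow_smul_eq_bot_of_isLocalRing (M := Qt R (ys ++ [z ^ (T + 1)]))
    (IsLocalRing.maximalIdeal R) (Ideal.IsPrime.ne_top inferInstance)
  have hnot : w ∉ (⨅ i : ℕ, IsLocalRing.maximalIdeal R ^ i • ⊤ :
      Submodule R (Qt R (ys ++ [z ^ (T + 1)]))) := by
    rw [hK]; exact fun h => hne ((Submodule.mem_bot R).1 h)
  rw [Submodule.mem_iInf, not_forall] at hnot
  obtain ⟨c, hc⟩ := hnot
  let S := IsLocalRing.maximalIdeal R ^ c • (⊤ : Submodule R (Qt R (ys ++ [z ^ (T + 1)])))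
  have hL : Tow X e (ModuleCat.of R (Qt R (ys ++ [z ^ (T + 1)]) ⧸ S)) := by
    refine (Tow.res hX e).finlen hk c _ ?_
    rw [eq_bot_iff, Submodule.smul_le]
    intro a ha v _
    rw [Submodule.mem_bot]
    exact quot_torsion _ _ a ha v
  have h0 := tow_kills hQR hkill e _ hL 0 (by omega) (Abelian.Ext.mk₀ (ModuleCat.ofHom S.mkQ))
  rw [← Abelian.Ext.mk₀_smul, Abelian.Ext.mk₀_eq_zero_iff] at h0
  have h1 : z ^ T • S.mkQ = 0 := congrArg ModuleCat.Hom.hom h0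
  have h2 := LinearMap.congr_fun h1 (Submodule.Quotient.mk 1)
  apply hc
  rw [LinearMap.smul_apply, ← map_smul, Submodule.mkQ_apply, LinearMap.zero_apply,
    Submodule.Quotient.mk_eq_zero] at h2
  exact h2

end G
end Paper

/-- over a CM local ring, a resolving subcategory of finite radius
containing an Ulrich module consists of maximal Cohen–Macaulay modules. -/
theorem stmt13 (R : Type) [CommRing R] [IsNoetherianRing R] [IsLocalRing R] (d : ℕ)
    (hdim : ringKrullDim R = (d : ℕ)) (hCM : DepthGE R R d)
    (X : ModuleCat.{0} R → Prop) (hX : Resolving R X) (hrad : FiniteRadius R X)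
    (U : ModuleCat.{0} R) (hU : X U) (hUl : Ulrich R d U) :
    ∀ M, X M → DepthGE R M d := 
  main_aux d hCM X hX hrad U hU hUl
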